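/- Let p: ℕ∖{0} → [0,1] be a probability distribution with p[x≥2] > 0 and τ a finite relational vocabulary. Then for every sentence ψ ∈ FO(τ), either there is a value j ∈ ℕ such that lim_{n→∞} μ_{n,p}[π⟦ψ⟧ = j] = 1, or lim_{n→∞} μ_{n,p}[π⟦ψ⟧ > j] = 1 for all j ∈ ℕ. -/

import Mathlib

open MeasureTheory Filter Set
open scoped ENNReal BigOperators

/-- A (fully instantiated) literal over the relational vocabulary given by the
relation symbols `R` with arities `ar`, on the universe `A`: a relation symbol,
a tuple of arguments, and a polarity (`true` = positive atom, `false` = negated atom). -/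
structure Lit (R : Type) (ar : R → ℕ) (A : Type) : Type where
  rel : R
  args : Fin (ar rel) → A
  pos : Bool

/-- A (fully instantiated) relational atom. -/
abbrev Atoms (R : Type) (ar : R → ℕ) (A : Type) : Type := (r : R) × (Fin (ar r) → A)

variable {R : Type} {ar : R → ℕ} {A B K : Type}

/-- Renaming of a literal along a map of universes. -/
def Lit.map (f : A → B) (l : Lit R ar A) : Lit R ar B :=
  ⟨l.rel, fun j => f (l.args j), l.pos⟩

/-- A `K`-interpretation (or atomic type) is model-defining / consistent (w.r.t. the
zero element `z` of `K`) if out of each pair of complementary literals exactly one is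
mapped to `z`. -/
def ModelDefining (z : K) (π : Lit R ar A → K) : Prop :=
  ∀ (r : R) (as : Fin (ar r) → A), (π ⟨r, as, true⟩ = z ↔ π ⟨r, as, false⟩ ≠ z)

/-- The atomic `m`-type realised by the tuple `a` in the interpretation `π`. -/
def typeOf {m : ℕ} (π : Lit R ar A → K) (a : Fin m → A) : Lit R ar (Fin m) → K :=
  fun l => π (l.map a)

/-- The tuple `a` (of pairwise distinct elements) realises the atomic `m`-type `ρ` in `π`. -/
def Realizes {m : ℕ} (π : Lit R ar A → K) (a : Fin m → A) (ρ : Lit R ar (Fin m) → K) : Prop :=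
  Function.Injective a ∧ typeOf π a = ρ

/-- The atomic `(m+1)`-type `ρp` extends the atomic `m`-type `ρ`. -/
def Extends {m : ℕ} (ρp : Lit R ar (Fin (m+1)) → K) (ρ : Lit R ar (Fin m) → K) : Prop :=
  ∀ l : Lit R ar (Fin m), ρp (l.map Fin.castSucc) = ρ l

/-- The `k`-extension property of an interpretation `π` (with zero element `z`). -/
def ExtProp (z : K) (π : Lit R ar A → K) (k : ℕ) : Prop :=
  ∀ m, m < k → ∀ ρ : Lit R ar (Fin m) → K, ModelDefining z ρ →
    ∀ ρp : Lit R ar (Fin (m+1)) → K, ModelDefining z ρp → Extends ρp ρ →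
      ∀ a : Fin m → A, Realizes π a ρ →
        ∃ b : A, b ∉ Set.range a ∧ Realizes π (Fin.snoc a b) ρp

/-- A sequence of extended nonnegative reals converges to `L` exponentially fast. -/
def ExpConv (f : ℕ → ℝ≥0∞) (L : ℝ≥0∞) : Prop :=
  ∃ C q : ℝ≥0∞, C ≠ ⊤ ∧ q < 1 ∧ ∀ n, f n ≤ L + C * q ^ n ∧ L ≤ f n + C * q ^ n

/-- The interpretation determined by a sample point: each atom gets a pair
(value of positive literal, value of negated literal). -/
def interpOf (ω : Atoms R ar A → K × K) : Lit R ar A → K :=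
  fun l => if l.pos then (ω ⟨l.rel, l.args⟩).1 else (ω ⟨l.rel, l.args⟩).2

/-- The per-atom distribution: with probability 1/2 the atom is true (its negation
gets value `z`, i.e. false, and its value is sampled from `p`), with probability 1/2
it is false (symmetrically). -/
noncomputable def atomMeasure [MeasurableSpace K] (z : K) (p : Measure K) : Measure (K × K) :=
  (2⁻¹ : ℝ≥0∞) • (Measure.map (fun j => (j, z)) p + Measure.map (fun j => (z, j)) p)

/-- The distribution `μ_{n,p}` of random `K`-interpretations on universe `[n]`,
presented on the sample space assigning to each atom the pair of values of its
positive and negated literal. -/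
noncomputable def muI [MeasurableSpace K] [Fintype R] (z : K) (p : Measure K) (n : ℕ) :
    Measure (Atoms R ar (Fin n) → K × K) :=
  Measure.pi fun _ => atomMeasure z p
/-- First-order formulae in negation normal form over the vocabulary `(R, ar)`,
with standard quantifiers, in a context of `i` variables (de Bruijn style:
`ex`/`all` bind the last variable of the extended context). -/
inductive FO (R : Type) (ar : R → ℕ) : ℕ → Type
  | eq   : {i : ℕ} → Fin i → Fin i → FO R ar i
  | ne   : {i : ℕ} → Fin i → Fin i → FO R ar i
  | atom : {i : ℕ} → (r : R) → (Fin (ar r) → Fin i) → Bool → FO R ar i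
  | or   : {i : ℕ} → FO R ar i → FO R ar i → FO R ar i
  | and  : {i : ℕ} → FO R ar i → FO R ar i → FO R ar i
  | ex   : {i : ℕ} → FO R ar (i+1) → FO R ar i
  | all  : {i : ℕ} → FO R ar (i+1) → FO R ar i

/-- Semiring semantics of first-order formulae over a commutative semiring `K`:
`∨`/`∃` are sums, `∧`/`∀` are products. -/
noncomputable def evalS [CommSemiring K] [Fintype A] [DecidableEq A]
    (π : Lit R ar A → K) : {i : ℕ} → FO R ar i → (Fin i → A) → K
  | _, .eq j l, v => if v j = v l then 1 else 0
  | _, .ne j l, v => if v j = v l then 0 else 1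
  | _, .atom r as pos, v => π ⟨r, fun j => v (as j), pos⟩
  | _, .or φ θ, v => evalS π φ v + evalS π θ v
  | _, .and φ θ, v => evalS π φ v * evalS π θ v
  | _, .ex φ, v => ∑ b : A, evalS π φ (Fin.snoc v b)
  | _, .all φ, v => ∏ b : A, evalS π φ (Fin.snoc v b)

/-- Semantics of first-order formulae in a lattice semiring (a bounded distributive
lattice, with `0 = ⊥`, `1 = ⊤`, addition `⊔` and multiplication `⊓`). -/
noncomputable def evalL [DistribLattice K] [BoundedOrder K] [Fintype A] [DecidableEq A]
    (π : Lit R ar A → K) : {i : ℕ} → FO R ar i → (Fin i → A) → K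
  | _, .eq j l, v => if v j = v l then ⊤ else ⊥
  | _, .ne j l, v => if v j = v l then ⊥ else ⊤
  | _, .atom r as pos, v => π ⟨r, fun j => v (as j), pos⟩
  | _, .or φ θ, v => evalL π φ v ⊔ evalL π θ v
  | _, .and φ θ, v => evalL π φ v ⊓ evalL π θ v
  | _, .ex φ, v => Finset.univ.sup fun b : A => evalL π φ (Fin.snoc v b)
  | _, .all φ, v => Finset.univ.inf fun b : A => evalL π φ (Fin.snoc v b)

/-- `y` vanishes exactly when `x` does, and reaches the threshold `2` whenever `x` does. -/
def ThresholdLE (x y : ℕ∞) : Prop := (x = 0 ↔ y = 0) ∧ (2 ≤ x → 2 ≤ y)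

theorem ThresholdLE.refl (x : ℕ∞) : ThresholdLE x x := ⟨Iff.rfl, id⟩

theorem ENat.two_le_iff {x : ℕ∞} : 2 ≤ x ↔ x ≠ 0 ∧ x ≠ 1 := by
  induction x using ENat.recTopCoe with
  | top => simp
  | coe n => exact_mod_cast (by omega : 2 ≤ n ↔ n ≠ 0 ∧ n ≠ 1)

theorem ThresholdLE.add {x y x' y' : ℕ∞} (h : ThresholdLE x x') (h' : ThresholdLE y y') :
    ThresholdLE (x + y) (x' + y') := by
  refine ⟨by simp [h.1, h'.1], fun h2 => ?_⟩
  by_cases hx : 2 ≤ x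
  · exact (h.2 hx).trans le_self_add
  by_cases hy : 2 ≤ y
  · exact (h'.2 hy).trans le_add_self
  have hx0 : x ≠ 0 := fun hx0 => hy (by simpa [hx0] using h2)
  have hy0 : y ≠ 0 := fun hy0 => hx (by simpa [hy0] using h2)
  rw [Ne, h.1, ← Ne, ← Order.one_le_iff_ne_zero] at hx0
  rw [Ne, h'.1, ← Ne, ← Order.one_le_iff_ne_zero] at hy0
  simpa [one_add_one_eq_two] using add_le_add hx0 hy0

theorem ThresholdLE.mul {x y x' y' : ℕ∞} (h : ThresholdLE x x') (h' : ThresholdLE y y') :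
    ThresholdLE (x * y) (x' * y') := by
  refine ⟨by simp [h.1, h'.1], fun h2 => ?_⟩
  have hne : x * y ≠ 0 := fun h0 => by simp [h0] at h2
  rw [mul_ne_zero_iff] at hne
  have hx := hne.1
  have hy := hne.2
  rw [Ne, h.1, ← Ne, ← Order.one_le_iff_ne_zero] at hx
  rw [Ne, h'.1, ← Ne, ← Order.one_le_iff_ne_zero] at hy
  by_cases hx2 : 2 ≤ x
  · simpa using mul_le_mul' (h.2 hx2) hy
  · by_cases hy2 : 2 ≤ y
    · simpa using mul_le_mul' hx (h'.2 hy2)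
    · simp only [ENat.two_le_iff, not_and, not_not] at hx2 hy2
      simp [hx2 hne.1, hy2 hne.2] at h2

theorem ThresholdLE.sum {ι : Type*} (s : Finset ι) {f g : ι → ℕ∞}
    (h : ∀ i, ThresholdLE (f i) (g i)) : ThresholdLE (∑ i ∈ s, f i) (∑ i ∈ s, g i) := by
  classical
  induction s using Finset.induction_on with
  | empty => simpa using ThresholdLE.refl 0
  | insert i s hi ih => simpa [Finset.sum_insert hi] using (h i).add ih

theorem ThresholdLE.prod {ι : Type*} (s : Finset ι) {f g : ι → ℕ∞}
    (h : ∀ i, ThresholdLE (f i) (g i)) : ThresholdLE (∏ i ∈ s, f i) (∏ i ∈ s, g i) := by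
  classical
  induction s using Finset.induction_on with
  | empty => simpa using ThresholdLE.refl 1
  | insert i s hi ih => simpa [Finset.prod_insert hi] using (h i).mul ih

theorem ThresholdLE.ite_ite {p p' q q' : Prop} [Decidable p] [Decidable p'] [Decidable q]
    [Decidable q'] (hp : p ↔ p') (hq : q → q') :
    ThresholdLE (if p then 0 else if q then ⊤ else 1) (if p' then 0 else if q' then ⊤ else 1) := by
  split_ifs <;> simp_all [ThresholdLE]

/-- The consistent one-point extensions of an atomic type. -/
def extensions {m : ℕ} (ρ : Lit R ar (Fin m) → ℕ) : Set (Lit R ar (Fin (m + 1)) → ℕ) :=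
  {ρ' | ModelDefining 0 ρ' ∧ Extends ρ' ρ}

open Classical in
/-- The limit value of a formula on a tuple of distinct elements of type `ρ`, the `i` variables
being assigned to entries of the tuple by `v`. -/
noncomputable def limitValue : {i : ℕ} → FO R ar i → (m : ℕ) → (Fin i → Fin m) →
    (Lit R ar (Fin m) → ℕ) → ℕ∞
  | _, .eq j l, _, v, _ => if v j = v l then 1 else 0
  | _, .ne j l, _, v, _ => if v j = v l then 0 else 1
  | _, .atom r as pos, _, v, ρ => ρ ⟨r, fun j => v (as j), pos⟩
  | _, .or φ θ, m, v, ρ => limitValue φ m v ρ + limitValue θ m v ρ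
  | _, .and φ θ, m, v, ρ => limitValue φ m v ρ * limitValue θ m v ρ
  | _, .ex φ, m, v, ρ => (∑ b : Fin m, limitValue φ m (Fin.snoc v b) ρ) +
      if ∃ ρ' ∈ extensions ρ,
        limitValue φ (m + 1) (Fin.snoc (Fin.castSucc ∘ v) (Fin.last m)) ρ' ≠ 0 then ⊤ else 0
  | _, .all φ, m, v, ρ => (∏ b : Fin m, limitValue φ m (Fin.snoc v b) ρ) *
      if ∃ ρ' ∈ extensions ρ,
        limitValue φ (m + 1) (Fin.snoc (Fin.castSucc ∘ v) (Fin.last m)) ρ' = 0 then 0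
      else if ∃ ρ' ∈ extensions ρ,
        2 ≤ limitValue φ (m + 1) (Fin.snoc (Fin.castSucc ∘ v) (Fin.last m)) ρ' then ⊤ else 1

theorem Lit.map_injective {f : A → B} (hf : Function.Injective f) :
    Function.Injective (Lit.map f : Lit R ar A → Lit R ar B) := by
  rintro ⟨r, as, s⟩ ⟨r', as', s'⟩ h
  simp only [Lit.map, Lit.mk.injEq] at h
  obtain ⟨rfl, h, rfl⟩ := h
  simp only [heq_eq_eq] at h
  rw [show as = as' from funext fun j => hf (congrFun h j)]

theorem ModelDefining.congr {π π' : Lit R ar A → ℕ} (h : ∀ l, π l = 0 ↔ π' l = 0)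
    (hπ : ModelDefining 0 π) : ModelDefining 0 π' := fun r as => by
  rw [← h, Ne, ← h]; exact hπ r as

/-- Replacing the base of an extension by a type with the same zeros again gives an extension. -/
theorem extend_mem_extensions {m : ℕ} {ρ σ : Lit R ar (Fin m) → ℕ} (h : ∀ l, ρ l = 0 ↔ σ l = 0)
    {ρ' : Lit R ar (Fin (m + 1)) → ℕ} (hρ' : ρ' ∈ extensions ρ) :
    Function.extend (Lit.map Fin.castSucc) σ ρ' ∈ extensions σ := by
  have hinj : Function.Injective (Lit.map (Fin.castSucc : Fin m → _) : Lit R ar _ → _) :=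
    Lit.map_injective (Fin.castSucc_injective m)
  refine ⟨hρ'.1.congr fun l => ?_, fun l => hinj.extend_apply _ _ l⟩
  by_cases hl : ∃ k, Lit.map Fin.castSucc k = l
  · obtain ⟨k, rfl⟩ := hl
    rw [hinj.extend_apply, hρ'.2 k, h]
  · rw [Function.extend_apply' _ _ _ hl]

theorem thresholdLE_extend {m : ℕ} {ρ σ : Lit R ar (Fin m) → ℕ}
    (h : ∀ l, ThresholdLE (ρ l) (σ l)) {ρ' : Lit R ar (Fin (m + 1)) → ℕ}
    (hρ' : ρ' ∈ extensions ρ) (l : Lit R ar (Fin (m + 1))) :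
    ThresholdLE (ρ' l) (Function.extend (Lit.map Fin.castSucc) σ ρ' l : ℕ) := by
  have hinj : Function.Injective (Lit.map (Fin.castSucc : Fin m → _) : Lit R ar _ → _) :=
    Lit.map_injective (Fin.castSucc_injective m)
  by_cases hl : ∃ k, Lit.map Fin.castSucc k = l
  · obtain ⟨k, rfl⟩ := hl
    rw [hinj.extend_apply, hρ'.2 k]; exact h k
  · rw [Function.extend_apply' _ _ _ hl]; exact .refl _

theorem extend_thresholdLE {m : ℕ} {ρ σ : Lit R ar (Fin m) → ℕ}
    (h : ∀ l, ThresholdLE (ρ l) (σ l)) {σ' : Lit R ar (Fin (m + 1)) → ℕ}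
    (hσ' : σ' ∈ extensions σ) (l : Lit R ar (Fin (m + 1))) :
    ThresholdLE (Function.extend (Lit.map Fin.castSucc) ρ σ' l : ℕ) (σ' l) := by
  have hinj : Function.Injective (Lit.map (Fin.castSucc : Fin m → _) : Lit R ar _ → _) :=
    Lit.map_injective (Fin.castSucc_injective m)
  by_cases hl : ∃ k, Lit.map Fin.castSucc k = l
  · obtain ⟨k, rfl⟩ := hl
    rw [hinj.extend_apply, hσ'.2 k]; exact h k
  · rw [Function.extend_apply' _ _ _ hl]; exact .refl _

open Classical in
theorem thresholdLE_limitValue {i : ℕ} (φ : FO R ar i) {m : ℕ} (v : Fin i → Fin m)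
    {ρ σ : Lit R ar (Fin m) → ℕ} (h : ∀ l, ThresholdLE (ρ l) (σ l)) :
    ThresholdLE (limitValue φ m v ρ) (limitValue φ m v σ) := by
  have hzero : ∀ {m : ℕ} {ρ σ : Lit R ar (Fin m) → ℕ}, (∀ l, ThresholdLE (ρ l) (σ l)) →
      ∀ l, ρ l = 0 ↔ σ l = 0 := fun h l => by simpa using (h l).1
  induction φ generalizing m with
  | eq => exact .refl _
  | ne => exact .refl _
  | atom => exact h _
  | or φ θ ihφ ihθ => exact (ihφ v h).add (ihθ v h)
  | and φ θ ihφ ihθ => exact (ihφ v h).mul (ihθ v h)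
  | ex φ ih =>
    refine (ThresholdLE.sum _ fun b => ih _ h).add ?_
    convert ThresholdLE.refl _ using 2
    refine ⟨fun ⟨σ', hσ', hne⟩ => ?_, fun ⟨ρ', hρ', hne⟩ => ?_⟩
    · exact ⟨_, extend_mem_extensions (fun l => (hzero h l).symm) hσ',
        fun h0 => hne ((ih _ (extend_thresholdLE h hσ')).1.1 h0)⟩
    · exact ⟨_, extend_mem_extensions (hzero h) hρ',
        fun h0 => hne ((ih _ (thresholdLE_extend h hρ')).1.2 h0)⟩
  | all φ ih =>
    simp only [limitValue]
    refine (ThresholdLE.prod _ fun b => ih _ h).mul ?_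
    refine ThresholdLE.ite_ite
      ⟨fun ⟨ρ', hρ', h0⟩ => ⟨_, extend_mem_extensions (hzero h) hρ',
        (ih _ (thresholdLE_extend h hρ')).1.1 h0⟩,
      fun ⟨σ', hσ', h0⟩ => ⟨_, extend_mem_extensions (fun l => (hzero h l).symm) hσ',
        (ih _ (extend_thresholdLE h hσ')).1.2 h0⟩⟩
      fun ⟨ρ', hρ', h2⟩ => ⟨_, extend_mem_extensions (hzero h) hρ',
        (ih _ (thresholdLE_extend h hρ')).2 h2⟩

/-- A finite value is attained exactly, an infinite one is only required to exceed `K`. -/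
def Approximates (K : ℕ) (x : ℕ∞) (y : ℕ) : Prop := x = y ∨ (x = ⊤ ∧ K < y)

theorem Approximates.add {K : ℕ} {x x' : ℕ∞} {y y' : ℕ} (h : Approximates K x y)
    (h' : Approximates K x' y') : Approximates K (x + x') (y + y') := by
  rcases h with rfl | ⟨rfl, h⟩
  · rcases h' with rfl | ⟨rfl, h'⟩
    · left; push_cast; rfl
    · right; exact ⟨by simp, by omega⟩
  · right; exact ⟨by simp, by omega⟩

theorem Approximates.mul {K : ℕ} {x x' : ℕ∞} {y y' : ℕ} (h : Approximates K x y)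
    (h' : Approximates K x' y') : Approximates K (x * x') (y * y') := by
  rcases h with rfl | ⟨rfl, h⟩ <;> rcases h' with rfl | ⟨rfl, h'⟩
  · left; push_cast; rfl
  · rcases Nat.eq_zero_or_pos y with rfl | hy
    · left; simp
    · right; exact ⟨ENat.mul_top (by exact_mod_cast hy.ne'), by nlinarith⟩
  · rcases Nat.eq_zero_or_pos y' with rfl | hy
    · left; simp
    · right; exact ⟨ENat.top_mul (by exact_mod_cast hy.ne'), by nlinarith⟩
  · right; exact ⟨by simp, by nlinarith⟩

theorem Approximates.sum {ι : Type*} {K : ℕ} (s : Finset ι) {f : ι → ℕ∞} {g : ι → ℕ}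
    (h : ∀ i, Approximates K (f i) (g i)) :
    Approximates K (∑ i ∈ s, f i) (∑ i ∈ s, g i) := by
  classical
  induction s using Finset.induction_on with
  | empty => left; simp
  | insert i s hi ih => simpa [Finset.sum_insert hi] using (h i).add ih

theorem Approximates.prod {ι : Type*} {K : ℕ} (s : Finset ι) {f : ι → ℕ∞} {g : ι → ℕ}
    (h : ∀ i, Approximates K (f i) (g i)) :
    Approximates K (∏ i ∈ s, f i) (∏ i ∈ s, g i) := by
  classical
  induction s using Finset.induction_on with
  | empty => left; simp
  | insert i s hi ih => simpa [Finset.prod_insert hi] using (h i).mul ih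

theorem Approximates.eq_zero_iff {K : ℕ} {x : ℕ∞} {y : ℕ} (h : Approximates K x y) :
    x = 0 ↔ y = 0 := by
  rcases h with rfl | ⟨rfl, h⟩
  · simp
  · simp; omega

theorem Approximates.two_le {K : ℕ} {x : ℕ∞} {y : ℕ} (h : Approximates (K + 1) x y)
    (hx : 2 ≤ x) : 2 ≤ y := by
  rcases h with rfl | ⟨rfl, h⟩
  · exact_mod_cast hx
  · omega

/-- Every consistent extension of the type of an `m`-tuple is realised, up to the threshold `2`,
by at least `N` elements outside of the tuple. -/
def ThresholdExtProp (π : Lit R ar A → ℕ) (m N : ℕ) : Prop :=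
  ∀ a : Fin m → A, Function.Injective a → ∀ ρ' ∈ extensions (typeOf π a),
    ∃ s : Finset A, N ≤ s.card ∧ ∀ b ∈ s, b ∉ Set.range a ∧
      ∀ l, ThresholdLE (ρ' l) (typeOf π (Fin.snoc a b : Fin (m + 1) → A) l : ℕ)

theorem injective_snoc {m : ℕ} {a : Fin m → A} (ha : Function.Injective a) {b : A}
    (hb : b ∉ Set.range a) : Function.Injective (Fin.snoc a b : Fin (m + 1) → A) :=
  Fin.snoc_injective_iff.2 ⟨ha, hb⟩

theorem snoc_comp_snoc {i m : ℕ} (a : Fin m → A) (b : A) (v : Fin i → Fin m) :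
    (Fin.snoc a b : Fin (m + 1) → A) ∘
      (Fin.snoc (Fin.castSucc ∘ v) (Fin.last m) : Fin (i + 1) → Fin (m + 1)) =
    Fin.snoc (a ∘ v) b := by
  rw [Fin.comp_snoc]
  congr 1
  · ext j; simp
  · simp

theorem typeOf_snoc_map_castSucc {m : ℕ} (π : Lit R ar A → ℕ) (a : Fin m → A) (b : A)
    (l : Lit R ar (Fin m)) :
    typeOf π (Fin.snoc a b : Fin (m + 1) → A) (Lit.map Fin.castSucc l) = typeOf π a l := by
  simp [typeOf, Lit.map]

theorem typeOf_snoc_mem_extensions {m : ℕ} {π : Lit R ar A → ℕ} (hπ : ModelDefining 0 π)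
    (a : Fin m → A) (b : A) :
    typeOf π (Fin.snoc a b : Fin (m + 1) → A) ∈ extensions (typeOf π a) :=
  ⟨fun r _ => hπ r _, typeOf_snoc_map_castSucc π a b⟩

theorem evalS_approximates {i : ℕ} (φ : FO R ar i) {m : ℕ} (v : Fin i → Fin m) (K : ℕ) :
    ∀ᶠ N in atTop, ∀ (n : ℕ) (π : Lit R ar (Fin n) → ℕ), ModelDefining 0 π →
      (∀ k < N, ThresholdExtProp π k N) → ∀ a : Fin m → Fin n, Function.Injective a →
      Approximates K (limitValue φ m v (typeOf π a)) (evalS π φ (a ∘ v)) := by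
  classical
  induction φ generalizing m K with
  | eq j l =>
    refine .of_forall fun N n π _ _ a ha => .inl ?_
    simp [limitValue, evalS, ha.eq_iff]
  | ne j l =>
    refine .of_forall fun N n π _ _ a ha => .inl ?_
    simp [limitValue, evalS, ha.eq_iff]
  | atom => exact .of_forall fun N n π _ _ a ha => .inl rfl
  | or φ θ ihφ ihθ =>
    filter_upwards [ihφ v K, ihθ v K] with N h h' n π hπ hext a ha
    exact (h n π hπ hext a ha).add (h' n π hπ hext a ha)
  | and φ θ ihφ ihθ =>
    filter_upwards [ihφ v K, ihθ v K] with N h h' n π hπ hext a ha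
    exact (h n π hπ hext a ha).mul (h' n π hπ hext a ha)
  | ex φ ih =>
    filter_upwards [eventually_all.2 fun b : Fin m => ih (Fin.snoc v b) K,
      ih (Fin.snoc (Fin.castSucc ∘ v) (Fin.last m)) K, eventually_gt_atTop m,
      eventually_gt_atTop K] with N hold hnew hm hK n π hπ hext a ha
    have hnew' : ∀ b ∉ Set.range a, Approximates K (limitValue φ (m + 1)
        (Fin.snoc (Fin.castSucc ∘ v) (Fin.last m)) (typeOf π (Fin.snoc a b : Fin (m + 1) → _)))
        (evalS π φ (Fin.snoc (a ∘ v) b)) := fun b hb => by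
      simpa only [snoc_comp_snoc] using hnew n π hπ hext _ (injective_snoc ha hb)
    simp only [limitValue, evalS]
    rw [← Finset.sum_add_sum_compl (Finset.univ.image a),
      Finset.sum_image fun x _ y _ h => ha h]
    refine (Approximates.sum _ fun b => ?_).add ?_
    · simpa only [Fin.comp_snoc] using hold b n π hπ hext a ha
    split_ifs with hex
    · obtain ⟨ρ', hρ', hne⟩ := hex
      obtain ⟨s, hs, hsb⟩ := hext m hm a ha ρ' hρ'
      refine .inr ⟨rfl, hK.trans_le (hs.trans ?_)⟩
      have hsub : s ⊆ (Finset.univ.image a)ᶜ := fun b hb => by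
        simpa using (hsb b hb).1
      refine le_trans ?_ (Finset.sum_le_sum_of_subset hsub)
      rw [Finset.card_eq_sum_ones]
      refine Finset.sum_le_sum fun b hb => Nat.one_le_iff_ne_zero.2 fun h0 => hne ?_
      exact (thresholdLE_limitValue φ _ (hsb b hb).2).1.2
        ((hnew' b (hsb b hb).1).eq_zero_iff.2 h0)
    · push Not at hex
      left
      rw [Finset.sum_eq_zero, Nat.cast_zero]
      intro b hb
      have hb' : b ∉ Set.range a := by simpa using hb
      exact (hnew' b hb').eq_zero_iff.1 (hex _ (typeOf_snoc_mem_extensions hπ a b))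
  | all φ ih =>
    filter_upwards [eventually_all.2 fun b : Fin m => ih (Fin.snoc v b) K,
      ih (Fin.snoc (Fin.castSucc ∘ v) (Fin.last m)) (K + 1), eventually_gt_atTop m,
      eventually_gt_atTop K] with N hold hnew hm hK n π hπ hext a ha
    have hnew' : ∀ b ∉ Set.range a, Approximates (K + 1) (limitValue φ (m + 1)
        (Fin.snoc (Fin.castSucc ∘ v) (Fin.last m)) (typeOf π (Fin.snoc a b : Fin (m + 1) → _)))
        (evalS π φ (Fin.snoc (a ∘ v) b)) := fun b hb => by
      simpa only [snoc_comp_snoc] using hnew n π hπ hext _ (injective_snoc ha hb)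
    simp only [limitValue, evalS]
    rw [← Finset.prod_mul_prod_compl (Finset.univ.image a),
      Finset.prod_image fun x _ y _ h => ha h]
    refine (Approximates.prod _ fun b => ?_).mul ?_
    · simpa only [Fin.comp_snoc] using hold b n π hπ hext a ha
    split_ifs with hzero htwo
    · obtain ⟨ρ', hρ', h0⟩ := hzero
      obtain ⟨s, hs, hsb⟩ := hext m hm a ha ρ' hρ'
      obtain ⟨b, hb⟩ := Finset.card_pos.1 (by omega : 0 < s.card)
      left
      rw [Finset.prod_eq_zero (i := b), Nat.cast_zero]
      · simpa using (hsb b hb).1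
      · exact (hnew' b (hsb b hb).1).eq_zero_iff.1
          ((thresholdLE_limitValue φ _ (hsb b hb).2).1.1 h0)
    · obtain ⟨ρ', hρ', h2⟩ := htwo
      obtain ⟨s, hs, hsb⟩ := hext m hm a ha ρ' hρ'
      push Not at hzero
      have hsub : s ⊆ (Finset.univ.image a)ᶜ := fun b hb => by
        simpa using (hsb b hb).1
      refine .inr ⟨rfl, hK.trans_le (hs.trans ?_)⟩
      refine (Nat.lt_two_pow_self (n := s.card)).le.trans ?_
      refine le_trans ?_ (Finset.prod_le_prod_of_subset_of_one_le' hsub fun b hb _ => ?_)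
      · rw [← Finset.prod_const]
        exact Finset.prod_le_prod' fun b hb => (hnew' b (hsb b hb).1).two_le
          ((thresholdLE_limitValue φ _ (hsb b hb).2).2 h2)
      · have hb' : b ∉ Set.range a := by simpa using hb
        exact Nat.one_le_iff_ne_zero.2 fun h0 =>
          hzero _ (typeOf_snoc_mem_extensions hπ a b) ((hnew' b hb').eq_zero_iff.2 h0)
    · push Not at hzero htwo
      left
      rw [Finset.prod_eq_one, Nat.cast_one]
      intro b hb
      have hb' : b ∉ Set.range a := by simpa using hb
      have hmem := typeOf_snoc_mem_extensions hπ a b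
      have h1 : limitValue φ (m + 1) (Fin.snoc (Fin.castSucc ∘ v) (Fin.last m))
          (typeOf π (Fin.snoc a b : Fin (m + 1) → _)) = 1 := by
        by_contra h1
        exact (htwo _ hmem).not_ge (ENat.two_le_iff.2 ⟨hzero _ hmem, h1⟩)
      have := hnew' b hb'
      rw [h1] at this
      rcases this with h | h
      · exact_mod_cast h.symm
      · simp at h

theorem pi_forall_not_le {ι J X : Type*} [Fintype ι] [MeasurableSpace X] [Countable X]
    [MeasurableSingletonClass X] (μ : Measure X)
    [IsProbabilityMeasure μ] {S : J → Finset ι} {t : J → ι → Set X}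
    {δ : ℝ≥0∞} {c : ℕ} (hδ : δ ≤ 1)
    (hc : ∀ j, (S j).card ≤ c) (s : Finset J) (hδt : ∀ j ∈ s, ∀ i ∈ S j, δ ≤ μ (t j i))
    (hS : (s : Set J).PairwiseDisjoint S) :
    Measure.pi (fun _ : ι => μ) {ω | ∀ j ∈ s, ¬ ∀ i ∈ S j, ω i ∈ t j i} ≤
      (1 - δ ^ c) ^ s.card := by
  classical
  have hone : ∀ j ∈ s, δ ^ c ≤ Measure.pi (fun _ : ι => μ) {ω | ∀ i ∈ S j, ω i ∈ t j i} :=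
    fun j hj => by
    have hpi : {ω : ι → X | ∀ i ∈ S j, ω i ∈ t j i} =
        Set.pi univ fun i => if i ∈ S j then t j i else univ := by
      ext ω
      simp only [mem_ofPred_eq, Set.mem_pi, mem_univ, true_imp_iff]
      refine forall_congr' fun i => ?_
      split_ifs with hi <;> simp [hi]
    rw [hpi, Measure.pi_pi, ← Finset.prod_subset (Finset.subset_univ (S j))
      fun i _ hi => by simp [hi]]
    calc δ ^ c ≤ δ ^ (S j).card := pow_le_pow_right_of_le_one' hδ (hc j)
      _ = ∏ i ∈ S j, δ := by simp
      _ ≤ _ := Finset.prod_le_prod' fun i hi => by simpa [hi] using hδt j hj i hi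
  induction s using Finset.induction_on with
  | empty => simp
  | insert j s hj ih =>
    have hind : ProbabilityTheory.iIndepFun (fun (i : ι) (ω : ι → X) => ω i)
        (Measure.pi fun _ : ι => μ) :=
      ProbabilityTheory.iIndepFun_pi (X := fun _ => id) fun _ => aemeasurable_id
    have hdisj : Disjoint (S j) (s.biUnion S) := by
      rw [Finset.disjoint_biUnion_right]
      intro k hk
      exact hS (by simp) (by simp [hk]) fun h => hj (h ▸ hk)
    have key := (hind.indepFun_finset (S j) (s.biUnion S) hdisj
      fun i => measurable_pi_apply i).measure_inter_preimage_eq_mul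
      {x | ¬ ∀ i : S j, x i ∈ t j i}
      {x | ∀ k, ∀ hk : k ∈ s, ¬ ∀ i, ∀ hi : i ∈ S k,
        x ⟨i, Finset.mem_biUnion.2 ⟨k, hk, hi⟩⟩ ∈ t k i} .of_discrete .of_discrete
    have hsplit : {ω : ι → X | ∀ k ∈ insert j s, ¬ ∀ i ∈ S k, ω i ∈ t k i} =
        {ω | ¬ ∀ i ∈ S j, ω i ∈ t j i} ∩ {ω | ∀ k ∈ s, ¬ ∀ i ∈ S k, ω i ∈ t k i} := by
      ext ω; simp
    rw [hsplit, Finset.card_insert_of_notMem hj, pow_succ']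
    refine le_trans (le_of_eq (?_ : _ = Measure.pi (fun _ : ι => μ)
      {ω | ¬ ∀ i ∈ S j, ω i ∈ t j i} * _)) (mul_le_mul' ?_
      (ih (fun k hk => hδt k (by simp [hk])) (hS.subset (by simp))
        fun k hk => hone k (by simp [hk])))
    · convert key using 2
      · ext ω; simp
      · congr 1; ext ω; simp
      · congr 1
    · rw [← compl_ofPred, prob_compl_eq_one_sub .of_discrete]
      exact tsub_le_tsub_left (hone j (by simp)) 1

/-- Renaming of an atom along a map of universes. -/
def atomMap (f : A → B) (α : Atoms R ar A) : Atoms R ar B := ⟨α.1, f ∘ α.2⟩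

theorem atomMap_injective {f : A → B} (hf : Function.Injective f) :
    Function.Injective (atomMap f : Atoms R ar A → Atoms R ar B) := by
  rintro ⟨r, as⟩ ⟨r', as'⟩ h
  simp only [atomMap, Sigma.mk.injEq] at h
  obtain ⟨rfl, h⟩ := h
  rw [hf.comp_left (heq_iff_eq.1 h)]

/-- The pairs of literal values making an atom true (`s = true`) or false with value at least
`2`. -/
def largeValues (s : Bool) : Set (ℕ × ℕ) :=
  if s then {x | 2 ≤ x.1 ∧ x.2 = 0} else {x | x.1 = 0 ∧ 2 ≤ x.2}

theorem le_atomMeasure_largeValues (p : Measure ℕ) (s : Bool) :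
    2⁻¹ * p {j | 2 ≤ j} ≤ atomMeasure 0 p (largeValues s) := by
  rw [atomMeasure, Measure.smul_apply, Measure.add_apply,
    Measure.map_apply .of_discrete .of_discrete, Measure.map_apply .of_discrete .of_discrete,
    smul_eq_mul]
  gcongr
  cases s
  · refine le_trans (le_of_eq ?_) le_add_self
    congr 1; ext; simp [largeValues]
  · refine le_trans (le_of_eq ?_) le_self_add
    congr 1; ext; simp [largeValues]

instance (p : Measure ℕ) [IsProbabilityMeasure p] : IsProbabilityMeasure (atomMeasure 0 p) := by
  constructor
  rw [atomMeasure, Measure.smul_apply, Measure.add_apply,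
    Measure.map_apply .of_discrete .of_discrete, Measure.map_apply .of_discrete .of_discrete]
  simp [one_add_one_eq_two, ENNReal.inv_mul_cancel]

instance [Fintype R] (p : Measure ℕ) [IsProbabilityMeasure p] (n : ℕ) :
    IsProbabilityMeasure (muI (ar := ar) 0 p n) := by
  unfold muI; infer_instance

/-- The atoms over `a` and `b` that involve `b` have the truth values prescribed by `σ`, and
value at least `2`. -/
def RealizesLarge {m : ℕ} (ω : Atoms R ar A → ℕ × ℕ) (a : Fin m → A)
    (σ : Atoms R ar (Fin (m + 1)) → Bool) (b : A) : Prop :=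
  ∀ α : Atoms R ar (Fin (m + 1)), Fin.last m ∈ Set.range α.2 →
    ω (atomMap (Fin.snoc a b : Fin (m + 1) → A) α) ∈ largeValues (σ α)

theorem RealizesLarge.thresholdLE {m : ℕ} {ω : Atoms R ar A → ℕ × ℕ} {a : Fin m → A} {b : A}
    {ρ' : Lit R ar (Fin (m + 1)) → ℕ} (hρ' : ρ' ∈ extensions (typeOf (interpOf ω) a))
    (h : RealizesLarge ω a (fun α => decide (ρ' ⟨α.1, α.2, true⟩ ≠ 0)) b)
    (l : Lit R ar (Fin (m + 1))) :
    ThresholdLE (ρ' l)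
      (typeOf (interpOf ω) (Fin.snoc a b : Fin (m + 1) → A) l : ℕ) := by
  obtain ⟨r, as, s⟩ := l
  by_cases hlast : Fin.last m ∈ Set.range as
  · have h1 := h ⟨r, as⟩ hlast
    have h2 := hρ'.1 r as
    change ThresholdLE _ ((if s = true then
      (ω (atomMap (Fin.snoc a b : Fin (m + 1) → A) ⟨r, as⟩)).1
      else (ω (atomMap (Fin.snoc a b : Fin (m + 1) → A) ⟨r, as⟩)).2 : ℕ) : ℕ∞)
    by_cases h0 : ρ' ⟨r, as, true⟩ = 0
    · have h3 := h2.1 h0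
      simp only [h0, ne_eq, not_true, decide_false, largeValues, Bool.false_eq_true, if_false,
        mem_ofPred_eq] at h1
      cases s
      · simp only [Bool.false_eq_true, if_false, ThresholdLE, Nat.cast_eq_zero]
        exact ⟨by omega, fun _ => by exact_mod_cast h1.2⟩
      · simp [ThresholdLE, h0, h1.1]
    · have h3 : ρ' ⟨r, as, false⟩ = 0 := by by_contra h3; exact h0 (h2.2 h3)
      simp only [h0, ne_eq, not_false_eq_true, decide_true, largeValues, if_true,
        mem_ofPred_eq] at h1
      cases s
      · simp [ThresholdLE, h3, h1.2]
      · simp only [if_true, ThresholdLE, Nat.cast_eq_zero]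
        exact ⟨by omega, fun _ => by exact_mod_cast h1.1⟩
  · have hne : ∀ j, as j ≠ Fin.last m := fun j hj => hlast ⟨j, hj⟩
    have hl : (⟨r, as, s⟩ : Lit R ar (Fin (m + 1))) =
        Lit.map Fin.castSucc ⟨r, fun j => (as j).castPred (hne j), s⟩ := by simp [Lit.map]
    rw [hl, hρ'.2, typeOf_snoc_map_castSucc]
    exact .refl _

theorem muI_forall_not_realizesLarge_le [Fintype R] (p : Measure ℕ) [IsProbabilityMeasure p]
    {n m N : ℕ} {a : Fin m → Fin n} (ha : Function.Injective a) (c : Fin N → Fin n)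
    (σ : Atoms R ar (Fin (m + 1)) → Bool) :
    muI 0 p n {ω | ∀ b, b ∉ Set.range a → b ∉ Set.range c → ¬ RealizesLarge ω a σ b} ≤
      (1 - (2⁻¹ * p {j | 2 ≤ j}) ^ Fintype.card (Atoms R ar (Fin (m + 1)))) ^ (n - (m + N)) := by
  classical
  have hδ : 2⁻¹ * p {j | 2 ≤ j} ≤ 1 :=
    mul_le_one' (by simp) prob_le_one
  let s : Finset (Fin n) := (Finset.univ.image a ∪ Finset.univ.image c)ᶜ
  have hs : ∀ {b}, b ∈ s ↔ b ∉ Set.range a ∧ b ∉ Set.range c := by simp [s]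
  have hcard : n - (m + N) ≤ s.card := by
    rw [Finset.card_compl, Fintype.card_fin]
    refine Nat.sub_le_sub_left ((Finset.card_union_le _ _).trans (add_le_add ?_ ?_)) _
    · simpa using Finset.card_image_le (s := Finset.univ) (f := a)
    · simpa using Finset.card_image_le (s := Finset.univ) (f := c)
  let newAtoms : Finset (Atoms R ar (Fin (m + 1))) := {α | Fin.last m ∈ Set.range α.2}
  let S : Fin n → Finset (Atoms R ar (Fin n)) := fun b =>
    newAtoms.image (atomMap (Fin.snoc a b : Fin (m + 1) → Fin n))
  let t : Fin n → Atoms R ar (Fin n) → Set (ℕ × ℕ) := fun b i =>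
    {x | ∀ α ∈ newAtoms, atomMap (Fin.snoc a b : Fin (m + 1) → Fin n) α = i →
      x ∈ largeValues (σ α)}
  have hbound := pi_forall_not_le (atomMeasure 0 p) (S := S) (t := t) hδ
    (fun b => Finset.card_image_le.trans (Finset.card_le_univ newAtoms)) s ?_ ?_
  · refine le_trans (measure_mono ?_)
      (hbound.trans (pow_le_pow_right_of_le_one' tsub_le_self hcard))
    intro ω hω b hb hall
    refine hω b (hs.1 hb).1 (hs.1 hb).2 fun α hα => ?_
    have hα' : α ∈ newAtoms := by simpa [newAtoms] using hα
    exact hall _ (Finset.mem_image_of_mem _ hα') α hα' rfl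
  · intro b hb i hi
    obtain ⟨α, hα, rfl⟩ := Finset.mem_image.1 hi
    refine (le_atomMeasure_largeValues p (σ α)).trans (measure_mono fun x hx α' _ h => ?_)
    rwa [atomMap_injective (injective_snoc ha (hs.1 hb).1) h]
  · intro b hb b' hb' hne
    refine Finset.disjoint_left.2 fun i hi hi' => ?_
    obtain ⟨⟨r, as⟩, hα, rfl⟩ := Finset.mem_image.1 hi
    obtain ⟨⟨r', as'⟩, hα', h⟩ := Finset.mem_image.1 hi'
    simp only [atomMap, Sigma.mk.injEq] at h
    obtain ⟨rfl, h⟩ := h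
    obtain ⟨j, hj⟩ : Fin.last m ∈ Set.range as := by simpa [newAtoms] using hα
    have hj' := congrFun (heq_iff_eq.1 h) j
    simp only [Function.comp_apply, hj, Fin.snoc_last] at hj'
    generalize as' j = x at hj'
    induction x using Fin.lastCases with
    | last => exact hne (by simpa using hj'.symm)
    | cast k => exact (hs.1 hb).1 ⟨k, by simpa using hj'⟩

theorem tendsto_pow_mul_pow_sub (d : ℕ) {D q : ℝ≥0∞} (hD : D ≠ ⊤) (hq : q < 1) :
    Tendsto (fun n : ℕ => (n : ℝ≥0∞) ^ d * D * q ^ (n - d)) atTop (nhds 0) := by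
  obtain ⟨r, hr0, hr1, hqr⟩ : ∃ r : ℝ, 0 < r ∧ r < 1 ∧ q ≤ ENNReal.ofReal r := by
    refine ⟨max q.toReal (1 / 2), by simp, max_lt ?_ (by norm_num), ?_⟩
    · simpa using (ENNReal.toReal_lt_toReal hq.ne_top ENNReal.one_ne_top).2 hq
    · exact (ENNReal.ofReal_toReal hq.ne_top).symm.le.trans
        (ENNReal.ofReal_le_ofReal (le_max_left _ _))
  have hreal : Tendsto (fun n : ℕ => (n : ℝ) ^ d * r ^ n * (D.toReal / r ^ d)) atTop (nhds 0) := by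
    simpa using (tendsto_pow_const_mul_const_pow_of_abs_lt_one d
      (by rwa [abs_of_pos hr0])).mul_const (D.toReal / r ^ d)
  have hlim := ENNReal.tendsto_ofReal hreal
  rw [ENNReal.ofReal_zero] at hlim
  refine tendsto_of_tendsto_of_tendsto_of_le_of_le' tendsto_const_nhds hlim
    (.of_forall fun _ => zero_le) ?_
  filter_upwards [eventually_ge_atTop d] with n hn
  have hpow : (n : ℝ) ^ d * r ^ n * (D.toReal / r ^ d) = (n : ℝ) ^ d * D.toReal * r ^ (n - d) := by
    rw [← Nat.sub_add_cancel hn, pow_add r, Nat.add_sub_cancel]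
    field_simp
  rw [hpow, ENNReal.ofReal_mul (by positivity), ENNReal.ofReal_mul (by positivity),
    ENNReal.ofReal_pow (by positivity), ENNReal.ofReal_pow hr0.le, ENNReal.ofReal_natCast,
    ENNReal.ofReal_toReal hD]
  gcongr

theorem exists_range_superset {n N : ℕ} (hn : 0 < n) (G : Finset (Fin n)) (hG : G.card ≤ N) :
    ∃ c : Fin N → Fin n, ∀ b ∈ G, b ∈ Set.range c := by
  refine ⟨fun i => if h : (i : ℕ) < G.card then G.equivFin.symm ⟨i, h⟩ else ⟨0, hn⟩,
    fun b hb => ⟨Fin.castLE hG (G.equivFin ⟨b, hb⟩), ?_⟩⟩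
  simp

theorem tendsto_muI_not_thresholdExtProp [Fintype R] (p : Measure ℕ) [IsProbabilityMeasure p]
    (hp : 0 < p {j : ℕ | 2 ≤ j}) (m N : ℕ) :
    Tendsto (fun n => muI (ar := ar) 0 p n {ω | ¬ ThresholdExtProp (interpOf ω) m N})
      atTop (nhds 0) := by
  classical
  set C := Fintype.card (Atoms R ar (Fin (m + 1))) with hC
  set q : ℝ≥0∞ := 1 - (2⁻¹ * p {j | 2 ≤ j}) ^ C with hq
  have hq1 : q < 1 := ENNReal.sub_lt_self ENNReal.one_ne_top one_ne_zero
    (pow_ne_zero _ (mul_ne_zero (by simp) hp.ne'))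
  refine tendsto_of_tendsto_of_tendsto_of_le_of_le' tendsto_const_nhds
    (tendsto_pow_mul_pow_sub (m + N) (D := 2 ^ C) (by simp) hq1)
    (.of_forall fun _ => zero_le) ?_
  filter_upwards [eventually_gt_atTop 0] with n hn
  let E : (Fin m → Fin n) → (Fin N → Fin n) → (Atoms R ar (Fin (m + 1)) → Bool) →
      Set (Atoms R ar (Fin n) → ℕ × ℕ) := fun a c σ => {ω | Function.Injective a ∧
    ∀ b, b ∉ Set.range a → b ∉ Set.range c → ¬ RealizesLarge ω a σ b}
  have hE : ∀ a c σ, muI 0 p n (E a c σ) ≤ q ^ (n - (m + N)) := fun a c σ => by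
    by_cases ha : Function.Injective a
    · have hset : E a c σ =
          {ω | ∀ b, b ∉ Set.range a → b ∉ Set.range c → ¬ RealizesLarge ω a σ b} := by
        ext; simp [E, ha]
      rw [hset]
      exact muI_forall_not_realizesLarge_le p ha c σ
    · simp [E, ha]
  have hsub : {ω | ¬ ThresholdExtProp (interpOf ω) m N} ⊆ ⋃ a, ⋃ c, ⋃ σ, E a c σ := by
    intro ω hω
    simp only [ThresholdExtProp, mem_ofPred_eq, not_forall] at hω
    obtain ⟨a, ha, ρ', hρ', hno⟩ := hω
    let σ : Atoms R ar (Fin (m + 1)) → Bool := fun α => decide (ρ' ⟨α.1, α.2, true⟩ ≠ 0)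
    let G : Finset (Fin n) := {b | b ∉ Set.range a ∧ RealizesLarge ω a σ b}
    have hG : G.card ≤ N := by
      by_contra! hlt
      exact hno ⟨G, hlt.le, fun b hb => by
        have hb' := (Finset.mem_filter.1 hb).2
        exact ⟨hb'.1, hb'.2.thresholdLE hρ'⟩⟩
    obtain ⟨c, hc⟩ := exists_range_superset hn G hG
    simp only [mem_iUnion]
    exact ⟨a, c, σ, ha, fun b hba hbc hb => hbc (hc b (by simp [G, hb]; simpa using hba))⟩
  calc muI 0 p n {ω | ¬ ThresholdExtProp (interpOf ω) m N}
      ≤ muI 0 p n (⋃ a, ⋃ c, ⋃ σ, E a c σ) := measure_mono hsub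
    _ ≤ ∑ a : Fin m → Fin n, ∑ c : Fin N → Fin n,
          ∑ σ : Atoms R ar (Fin (m + 1)) → Bool, q ^ (n - (m + N)) := by
        refine (measure_iUnion_fintype_le _ _).trans (Finset.sum_le_sum fun a _ => ?_)
        refine (measure_iUnion_fintype_le _ _).trans (Finset.sum_le_sum fun c _ => ?_)
        exact (measure_iUnion_fintype_le _ _).trans (Finset.sum_le_sum fun σ _ => hE a c σ)
    _ = (n : ℝ≥0∞) ^ (m + N) * 2 ^ C * q ^ (n - (m + N)) := by
        simp only [Finset.sum_const, Finset.card_univ, Fintype.card_fun, Fintype.card_fin,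
          Fintype.card_bool, nsmul_eq_mul, Nat.cast_pow, ← hC, pow_add]
        push_cast
        ring

theorem muI_not_modelDefining [Fintype R] (p : Measure ℕ) [IsProbabilityMeasure p]
    (hp : p {0} = 0) (n : ℕ) :
    muI (ar := ar) 0 p n {ω | ¬ ModelDefining 0 (interpOf ω)} = 0 := by
  have hsub : {ω : Atoms R ar (Fin n) → ℕ × ℕ | ¬ ModelDefining 0 (interpOf ω)} ⊆
      ⋃ α, Function.eval α ⁻¹' {x | ¬ (x.1 = 0 ↔ x.2 ≠ 0)} := by
    intro ω hω
    simp only [ModelDefining, mem_ofPred_eq, not_forall] at hω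
    obtain ⟨r, as, h⟩ := hω
    exact mem_iUnion.2 ⟨⟨r, as⟩, by simpa [interpOf] using h⟩
  refine measure_mono_null hsub (measure_iUnion_null fun α => ?_)
  rw [muI, (measurePreserving_eval _ α).measure_preimage
      (MeasurableSet.of_discrete).nullMeasurableSet,
    atomMeasure, Measure.smul_apply, Measure.add_apply,
    Measure.map_apply .of_discrete .of_discrete, Measure.map_apply .of_discrete .of_discrete]
  simp [hp]

theorem tendsto_muI_one [Fintype R] (p : Measure ℕ) [IsProbabilityMeasure p] (hp0 : p {0} = 0)
    (hp2 : 0 < p {j : ℕ | 2 ≤ j}) (E : ∀ n, Set (Atoms R ar (Fin n) → ℕ × ℕ)) (N : ℕ)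
    (hE : ∀ n ω, ModelDefining 0 (interpOf ω) →
      (∀ k < N, ThresholdExtProp (interpOf ω) k N) → ω ∈ E n) :
    Tendsto (fun n => muI 0 p n (E n)) atTop (nhds 1) := by
  have hsum : Tendsto (fun n => ∑ k ∈ Finset.range N,
      muI (ar := ar) 0 p n {ω | ¬ ThresholdExtProp (interpOf ω) k N}) atTop (nhds 0) := by
    simpa using tendsto_finsetSum (Finset.range N)
      fun k _ => tendsto_muI_not_thresholdExtProp (R := R) (ar := ar) p hp2 k N
  have hcompl : Tendsto (fun n => muI 0 p n (E n)ᶜ) atTop (nhds 0) := by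
    refine tendsto_of_tendsto_of_tendsto_of_le_of_le tendsto_const_nhds hsum
      (fun _ => zero_le) fun n => ?_
    have hsub : (E n)ᶜ ⊆ {ω | ¬ ModelDefining 0 (interpOf ω)} ∪
        ⋃ k ∈ Finset.range N, {ω | ¬ ThresholdExtProp (interpOf ω) k N} := by
      intro ω hω
      by_contra hno
      simp only [mem_union, mem_ofPred_eq, mem_iUnion, Finset.mem_range, exists_prop, not_or,
        not_exists, not_and, not_not] at hno
      exact hω (hE n ω hno.1 hno.2)
    calc muI 0 p n (E n)ᶜ ≤ _ := (measure_mono hsub).trans (measure_union_le _ _)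
      _ ≤ _ := by
        rw [muI_not_modelDefining p hp0, zero_add]
        exact measure_biUnion_finset_le _ _
  have hsub := ENNReal.Tendsto.sub (tendsto_const_nhds (x := (1 : ℝ≥0∞))) hcompl (by simp)
  rw [tsub_zero] at hsub
  refine hsub.congr fun n => ?_
  rw [prob_compl_eq_one_sub .of_discrete, ENNReal.sub_sub_cancel ENNReal.one_ne_top prob_le_one]

/-- (0-1 law for FO on the natural semiring.) Let `p` be a
probability distribution on `ℕ ∖ {0}` with `p[x ≥ 2] > 0`.  Then for every sentence
`ψ`, either there is `j ∈ ℕ` such that `μ_{n,p}[π⟦ψ⟧ = j] → 1`, or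
`μ_{n,p}[π⟦ψ⟧ > j] → 1` for every `j ∈ ℕ`. -/
theorem statement_16
    {R : Type} [Fintype R] [DecidableEq R]
    {ar : R → ℕ} (har : ∀ r, 0 < ar r)
    (p : Measure ℕ) [IsProbabilityMeasure p]
    (hp0 : p {0} = 0) (hp2 : 0 < p {j : ℕ | 2 ≤ j})
    (ψ : FO R ar 0) :
    (∃ j : ℕ, Tendsto (fun n =>
        muI (ar := ar) (0 : ℕ) p n {ω | evalS (interpOf ω) ψ Fin.elim0 = j})
      atTop (nhds 1)) ∨
    (∀ j : ℕ, Tendsto (fun n =>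
        muI (ar := ar) (0 : ℕ) p n {ω | j < evalS (interpOf ω) ψ Fin.elim0})
      atTop (nhds 1)) := by
  have : IsEmpty (Lit R ar (Fin 0)) := ⟨fun l => (l.args ⟨0, har l.rel⟩).elim0⟩
  have hlim := fun K => eventually_atTop.1 (evalS_approximates ψ (m := 0) Fin.elim0 K)
  rcases hx : limitValue ψ 0 Fin.elim0 isEmptyElim with _ | j
  · right
    intro j
    obtain ⟨N, hN⟩ := hlim j
    refine tendsto_muI_one p hp0 hp2 _ N fun n ω hω hext => ?_
    have h := hN N le_rfl n _ hω hext Fin.elim0 (Function.injective_of_subsingleton _)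
    rw [Subsingleton.elim (typeOf _ _) isEmptyElim, hx, Subsingleton.elim (_ ∘ _) Fin.elim0] at h
    rcases h with h | h
    · exact absurd h.symm (ENat.natCast_ne_top _)
    · exact h.2
  · left
    refine ⟨j, ?_⟩
    obtain ⟨N, hN⟩ := hlim 0
    refine tendsto_muI_one p hp0 hp2 _ N fun n ω hω hext => ?_
    have h := hN N le_rfl n _ hω hext Fin.elim0 (Function.injective_of_subsingleton _)
    rw [Subsingleton.elim (typeOf _ _) isEmptyElim, hx, Subsingleton.elim (_ ∘ _) Fin.elim0] at h
    rcases h with h | h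
    · exact (ENat.natCast_inj.1 h).symm
    · exact absurd h.1 (ENat.natCast_ne_top _)
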